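/- arXiv:1702.01377 — 2 statements merged into one kernel-verified Lean document; each statement's English description precedes it below -/
import Mathlib

section
/- Let k=(k_1,…,k_r) be a nonempty index of weight k=wt(k), and let N≥1 be an integer. Then s⋆(k,N) equals the iterated integral over the domain Δ(k): s⋆(k,N) = ∫_{Δ(k)} ω_{δ(1)}(t_1)⋯ω_{δ(k−1)}(t_{k−1}) · t_k^{N−1} dt_k, where ω_0(t)=dt/t, ω_1(t)=dt/(1−t), and δ(j)=1 if j∈A(k), δ(j)=0 otherwise. -/
open MeasureTheory Filter Topology

namespace Kawashima

/-- The set `A(k) = {k₁, k₁+k₂, …, k₁+⋯+k_{r-1}}` of proper nonempty partial sums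
of an index `k = (k₁, …, k_r)`. -/
def Aset (k : List ℕ) : Finset ℕ :=
  (Finset.Ico 1 k.length).image (fun i => (k.take i).sum)

/-- The Hoffman dual of an index `k`: the unique index `k∨` with the same weight such
that `A(k)` and `A(k∨)` partition `{1, …, wt(k) - 1}`.  It is computed here as the
composition of `wt(k)` whose partial-sum set is the complement of `A(k)`. -/
def hdual (k : List ℕ) : List ℕ :=
  let w := k.sum
  let L := (insert w ((Finset.Icc 1 (w - 1)) \ Aset k)).sort (· ≤ ·)
  L.zipWith (fun a b => a - b) (0 :: L)

/-- `sStar k N = s⋆(k, N) = Σ_{0 < m₁ ≤ ⋯ ≤ m_{r-1} ≤ m_r = N} 1/(m₁^{k₁} ⋯ m_r^{k_r})`.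
For the empty index the value is `1` (empty product), and for a nonempty index and
`N = 0` the value is `0` (empty sum). -/
noncomputable def sStar (k : List ℕ) (N : ℕ) : ℝ :=
  ∑ m : Fin k.length → Fin (N + 1),
    if (∀ i, 0 < (m i : ℕ)) ∧
       (∀ i j : Fin k.length, i ≤ j → (m i : ℕ) ≤ (m j : ℕ)) ∧
       (∀ i : Fin k.length, (i : ℕ) + 1 = k.length → (m i : ℕ) = N)
    then ∏ i : Fin k.length, 1 / ((m i : ℕ) : ℝ) ^ k.get i
    else 0

/-- `SStar k N = S⋆(k, N) = Σ_{n=1}^N s⋆(k, n)`. -/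
noncomputable def SStar (k : List ℕ) (N : ℕ) : ℝ :=
  ∑ n ∈ Finset.Icc 1 N, sStar k n

/-- The binomial coefficient `binom(z, n) = z(z-1)⋯(z-n+1)/n!` for complex `z`. -/
noncomputable def cbinom (z : ℂ) (n : ℕ) : ℂ :=
  (descPochhammer ℂ n).eval z / (n.factorial : ℂ)

/-- The Kawashima function
`F_k(z) = Σ_{n=1}^∞ (-1)^{n-1} s⋆(k∨, n) binom(z, n)`, with `F_∅(z) = 1`. -/
noncomputable def F (k : List ℕ) (z : ℂ) : ℂ :=
  if k = [] then 1
  else ∑' n : ℕ, (-1 : ℂ) ^ n * ((sStar (hdual k) (n + 1) : ℝ) : ℂ) * cbinom z (n + 1)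

/-- The domain `Δ(k) ⊆ (0,1)^{wt(k)}`: `t_j < t_{j+1}` if `j ∈ A(k)` and
`t_j > t_{j+1}` otherwise (positions `1`-indexed). -/
def Delta (k : List ℕ) : Set (Fin k.sum → ℝ) :=
  {t | (∀ j, t j ∈ Set.Ioo (0 : ℝ) 1) ∧
       ∀ (i : Fin k.sum) (h : (i : ℕ) + 1 < k.sum),
         if (i : ℕ) + 1 ∈ Aset k then t i < t ⟨(i : ℕ) + 1, h⟩
         else t ⟨(i : ℕ) + 1, h⟩ < t i}

/-- The multiple zeta value `ζ(k) = Σ_{0 < m₁ < ⋯ < m_r} 1/(m₁^{k₁} ⋯ m_r^{k_r})`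
(as a `tsum`; it converges for admissible `k`), with `ζ(∅) = 1`. -/
noncomputable def mzv (k : List ℕ) : ℝ :=
  ∑' m : Fin k.length → ℕ,
    if (∀ i, 0 < m i) ∧ (∀ i j : Fin k.length, i < j → m i < m j)
    then ∏ i : Fin k.length, 1 / ((m i : ℕ) : ℝ) ^ k.get i
    else 0

/-- `ζ` extended `ℚ`-linearly to formal `ℚ`-linear combinations of indices. -/
noncomputable def zetaL (v : List ℕ →₀ ℚ) : ℝ :=
  v.sum fun k a => (a : ℝ) * mzv k

/-- The Kawashima function extended `ℚ`-linearly to formal combinations of indices. -/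
noncomputable def FL (v : List ℕ →₀ ℚ) (z : ℂ) : ℂ :=
  v.sum fun k a => (a : ℂ) * F k z

/-- Auxiliary harmonic product, on *reversed* indices (so that the rightmost entry of
the index is the head of the list):
`k * l = (k₋ * l, k_r) + (k * l₋, l_s) + (k₋ * l₋, k_r + l_s)`. -/
noncomputable def hstarAux : List ℕ → List ℕ → (List ℕ →₀ ℚ)
  | [], l => Finsupp.single l 1
  | a :: k, [] => Finsupp.single (a :: k) 1
  | a :: k, b :: l =>
      Finsupp.mapDomain (List.cons a) (hstarAux k (b :: l)) +
      Finsupp.mapDomain (List.cons b) (hstarAux (a :: k) l) +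
      Finsupp.mapDomain (List.cons (a + b)) (hstarAux k l)
  termination_by k l => k.length + l.length

/-- The harmonic product `k * l` of two indices, as a `ℚ`-linear combination of
indices. -/
noncomputable def hstar (k l : List ℕ) : List ℕ →₀ ℚ :=
  Finsupp.mapDomain List.reverse (hstarAux k.reverse l.reverse)

/-- Auxiliary product `*̄` on reversed indices:
`k *̄ l = (k₋ *̄ l, k_r) + (k *̄ l₋, l_s) - (k₋ *̄ l₋, k_r + l_s)`. -/
noncomputable def hbarAux : List ℕ → List ℕ → (List ℕ →₀ ℚ)
  | [], l => Finsupp.single l 1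
  | a :: k, [] => Finsupp.single (a :: k) 1
  | a :: k, b :: l =>
      Finsupp.mapDomain (List.cons a) (hbarAux k (b :: l)) +
      Finsupp.mapDomain (List.cons b) (hbarAux (a :: k) l) -
      Finsupp.mapDomain (List.cons (a + b)) (hbarAux k l)
  termination_by k l => k.length + l.length

/-- The harmonic product `k *̄ l` of two indices. -/
noncomputable def hbar (k l : List ℕ) : List ℕ →₀ ℚ :=
  Finsupp.mapDomain List.reverse (hbarAux k.reverse l.reverse)

/-- The product `k ⊛ l = (k₋ * l₋, k_r + l_s)` for nonempty indices `k`, `l`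
(and `0` if either is empty). -/
noncomputable def circAst (k l : List ℕ) : List ℕ →₀ ℚ :=
  match k.reverse, l.reverse with
  | a :: k', b :: l' =>
      Finsupp.mapDomain List.reverse
        (Finsupp.mapDomain (List.cons (a + b)) (hstarAux k' l'))
  | _, _ => 0

/-- `⊛` extended bilinearly to formal combinations. -/
noncomputable def circAstL (v w : List ℕ →₀ ℚ) : List ℕ →₀ ℚ :=
  v.sum fun k a => w.sum fun l b => (a * b) • circAst k l

/-- The star operator `k ↦ k⋆`: the sum over all ways to replace commas by pluses
in groups of consecutive entries,
`(k₁,…,k_r)⋆ = Σ_{0<j₁<⋯<j_q=r} (k₁+⋯+k_{j₁}, …, k_{j_{q-1}+1}+⋯+k_{j_q})`. -/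
noncomputable def starOp : List ℕ → (List ℕ →₀ ℚ)
  | [] => Finsupp.single [] 1
  | [a] => Finsupp.single [a] 1
  | a :: b :: k =>
      Finsupp.mapDomain (List.cons a) (starOp (b :: k)) + starOp ((a + b) :: k)
  termination_by k => k.length

/-- The star operator extended `ℚ`-linearly. -/
noncomputable def starL (v : List ℕ →₀ ℚ) : List ℕ →₀ ℚ :=
  v.sum fun k a => a • starOp k

open Classical in
/-- Kawashima's function `G_k(z)`: the sum over tuples `0 < n₁, …, n_w` with
`n_j < n_{j+1}` if `j ∉ A(k)` and `n_j ≤ n_{j+1}` if `j ∈ A(k)`, of the product of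
the factors `1/(n_j + z)` at positions `j ∈ A(k)`, the factor
`1/n_w - 1/(n_w + z)` at the last position, and `1/n_j` elsewhere. -/
noncomputable def G (k : List ℕ) (z : ℂ) : ℂ :=
  ∑' n : Fin k.sum → ℕ,
    if (∀ j, 0 < n j) ∧
       (∀ (i : Fin k.sum) (h : (i : ℕ) + 1 < k.sum),
          if (i : ℕ) + 1 ∈ Aset k then n i ≤ n ⟨(i : ℕ) + 1, h⟩
          else n i < n ⟨(i : ℕ) + 1, h⟩)
    then ∏ j : Fin k.sum,
      if (j : ℕ) + 1 = k.sum then 1 / ((n j : ℕ) : ℂ) - 1 / (((n j : ℕ) : ℂ) + z)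
      else if (j : ℕ) + 1 ∈ Aset k then 1 / (((n j : ℕ) : ℂ) + z)
      else 1 / ((n j : ℕ) : ℂ)
    else 0

open Classical in
/-- `ζ_k(l) = Σ 1/(n₁^{l₁} ⋯ n_w^{l_w})`, summed over the same set of tuples as in
the definition of `G_k`. -/
noncomputable def zetaIdx (k : List ℕ) (l : List ℕ) : ℝ :=
  ∑' n : Fin k.sum → ℕ,
    if (∀ j, 0 < n j) ∧
       (∀ (i : Fin k.sum) (h : (i : ℕ) + 1 < k.sum),
          if (i : ℕ) + 1 ∈ Aset k then n i ≤ n ⟨(i : ℕ) + 1, h⟩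
          else n i < n ⟨(i : ℕ) + 1, h⟩)
    then ∏ j : Fin k.sum, 1 / ((n j : ℕ) : ℝ) ^ (l.getD (j : ℕ) 0)
    else 0

/-- `C_m(k) = Σ_{l₁,…,l_{r-1} ≥ 0, l_r ≥ 1, l₁+⋯+l_r = m}
ζ_k(1,…,1 (k₁-1 ones), l₁+1, …, 1,…,1 (k_r-1 ones), l_r+1)`. -/
noncomputable def Cm (k : List ℕ) (m : ℕ) : ℝ :=
  ∑ l : Fin k.length → Fin (m + 1),
    if (∑ i, (l i : ℕ)) = m ∧
       (∀ i : Fin k.length, (i : ℕ) + 1 = k.length → 1 ≤ (l i : ℕ))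
    then zetaIdx k
      ((List.ofFn (fun i : Fin k.length =>
          List.replicate (k.get i - 1) 1 ++ [(l i : ℕ) + 1])).flatten)
    else 0

/-- The iterated integral `A_m(k)` over `Δ((k,1,…,1))` (`m` trailing ones) of
`ω_{δ(1)}(t₁) ⋯ ω_{δ(w-1)}(t_{w-1}) · dt_w/(1-t_w) · dt_{w+1}/t_{w+1} ⋯ dt_{w+m}/t_{w+m}`. -/
noncomputable def Aint (k : List ℕ) (m : ℕ) : ℝ :=
  ∫ t in Delta (k ++ List.replicate m 1),
    ∏ i : Fin (k ++ List.replicate m 1).sum,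
      if (i : ℕ) + 1 < k.sum then
        (if (i : ℕ) + 1 ∈ Aset k then 1 / (1 - t i) else 1 / t i)
      else if (i : ℕ) + 1 = k.sum then 1 / (1 - t i)
      else 1 / t i

/-- The digamma function `ψ(z) = Γ'(z)/Γ(z)`. -/
noncomputable def digamma (z : ℂ) : ℂ := deriv Complex.Gamma z / Complex.Gamma z


open scoped ENNReal

/-! ### The recursion for the truncated star sums -/

/-- The sum defining `sStar`, with entries bounded by `M` and last entry equal to `n`. -/
noncomputable def starSum (r : ℕ) (e : Fin r → ℕ) (M n : ℕ) : ℝ :=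
  ∑ m : Fin r → Fin (M + 1),
    if (∀ i, 0 < (m i : ℕ)) ∧
       (∀ i j : Fin r, i ≤ j → (m i : ℕ) ≤ (m j : ℕ)) ∧
       (∀ i : Fin r, (i : ℕ) + 1 = r → (m i : ℕ) = n)
    then ∏ i : Fin r, 1 / ((m i : ℕ) : ℝ) ^ e i
    else 0

lemma sStar_eq_starSum (k : List ℕ) (N : ℕ) : sStar k N = starSum k.length k.get N N := rfl

lemma sStar_nonneg (k : List ℕ) (N : ℕ) : 0 ≤ sStar k N := by
  unfold sStar
  refine Finset.sum_nonneg fun m _ => ?_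
  split_ifs
  · positivity
  · exact le_rfl

lemma starSum_cast {r r' : ℕ} (h : r = r') (e : Fin r → ℕ) (e' : Fin r' → ℕ)
    (he : ∀ i, e i = e' (Fin.cast h i)) (M n : ℕ) : starSum r e M n = starSum r' e' M n := by
  subst h
  congr 1
  funext i
  exact he i

lemma starSum_bound (r : ℕ) (e : Fin (r + 1) → ℕ) {M n : ℕ} (h : n ≤ M) :
    starSum (r + 1) e M n = starSum (r + 1) e n n := by
  symm
  unfold starSum
  refine Finset.sum_of_injOn (fun m i => Fin.castLE (Nat.succ_le_succ h) (m i)) ?_ ?_ ?_ ?_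
  · intro m _ m' _ hm
    funext i
    exact Fin.castLE_injective _ (congrFun hm i)
  · intro m _
    simp
  · intro m _ hm
    refine if_neg ?_
    rintro ⟨-, h2, h3⟩
    refine hm ⟨fun i => ⟨m i, ?_⟩, by simp, ?_⟩
    · have := h2 i (Fin.last r) (Fin.le_last i)
      rw [h3 (Fin.last r) (by simp)] at this
      omega
    · funext i
      rfl
  · intro m _
    rfl

lemma starSum_one (e : Fin 1 → ℕ) {N : ℕ} (hN : 1 ≤ N) :
    starSum 1 e N N = 1 / (N : ℝ) ^ e 0 := by
  unfold starSum
  rw [Finset.sum_eq_single (fun _ => Fin.last N)]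
  · rw [if_pos]
    · simp
    · simp
      omega
  · intro m _ hm
    refine if_neg ?_
    rintro ⟨-, -, h3⟩
    refine hm ?_
    funext i
    apply Fin.ext
    simpa using h3 i (by omega)
  · simp

lemma starSum_snoc (r : ℕ) (e : Fin (r + 2) → ℕ) {N : ℕ} (hN : 1 ≤ N) :
    starSum (r + 2) e N N =
      1 / (N : ℝ) ^ e (Fin.last (r + 1)) *
        ∑ n ∈ Finset.Icc 1 N, starSum (r + 1) (fun i => e i.castSucc) N n := by
  have hL : starSum (r + 2) e N N = ∑ m : Fin (r + 1) → Fin (N + 1),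
      if (∀ i, 0 < (m i : ℕ)) ∧ (∀ i j : Fin (r + 1), i ≤ j → (m i : ℕ) ≤ (m j : ℕ))
      then 1 / (N : ℝ) ^ e (Fin.last (r + 1)) * ∏ i, 1 / ((m i : ℕ) : ℝ) ^ e i.castSucc
      else 0 := by
    unfold starSum
    rw [← (Fin.snocEquiv fun _ => Fin (N + 1)).sum_comp, Fintype.sum_prod_type,
      Finset.sum_eq_single (Fin.last N)]
    · refine Finset.sum_congr rfl fun m _ => ?_
      refine if_congr ?_ ?_ rfl
      · simp only [Fin.snocEquiv, Equiv.coe_fn_mk]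
        constructor
        · rintro ⟨h1, h2, -⟩
          exact ⟨fun i => by simpa using h1 i.castSucc,
            fun i j hij => by simpa using h2 i.castSucc j.castSucc hij⟩
        · rintro ⟨h1, h2⟩
          refine ⟨fun i => ?_, fun i j hij => ?_, fun i hi => ?_⟩
          · induction i using Fin.lastCases with
            | last => simpa using Nat.lt_of_lt_of_le Nat.zero_lt_one hN
            | cast i => simpa using h1 i
          · induction j using Fin.lastCases with
            | last => simpa using Fin.is_le _
            | cast j =>
              induction i using Fin.lastCases with
              | last => exact absurd hij (by simp)
              | cast i => simpa using h2 i j hij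
          · rw [show i = Fin.last (r + 1) from Fin.ext (by simpa using hi)]
            simp
      · rw [Fin.prod_univ_castSucc, mul_comm]
        simp [Fin.snocEquiv]
    · intro x _ hx
      refine Finset.sum_eq_zero fun m _ => if_neg ?_
      rintro ⟨-, -, h3⟩
      refine hx (Fin.ext ?_)
      simpa [Fin.snocEquiv] using h3 (Fin.last (r + 1)) (by simp)
    · simp
  rw [hL]
  unfold starSum
  rw [Finset.sum_comm, Finset.mul_sum]
  refine Finset.sum_congr rfl fun m _ => ?_
  split_ifs with h
  · rw [Finset.sum_eq_single (m (Fin.last r) : ℕ)]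
    · rw [if_pos]
      refine ⟨h.1, h.2, fun i hi => ?_⟩
      rw [show i = Fin.last r from Fin.ext (by simpa using hi)]
    · intro n _ hn
      refine if_neg ?_
      rintro ⟨-, -, h3⟩
      exact hn (h3 (Fin.last r) (by simp)).symm
    · intro hn
      refine absurd (Finset.mem_Icc.2 ⟨h.1 _, ?_⟩) hn
      omega
  · rw [Finset.sum_eq_zero, mul_zero]
    intro n _
    exact if_neg fun h' => h ⟨h'.1, h'.2.1⟩

lemma sStar_singleton (a : ℕ) {N : ℕ} (hN : 1 ≤ N) : sStar [a] N = 1 / (N : ℝ) ^ a :=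
  starSum_one _ hN

lemma sStar_append (k : List ℕ) (hk : k ≠ []) (a : ℕ) {N : ℕ} (hN : 1 ≤ N) :
    sStar (k ++ [a]) N = 1 / (N : ℝ) ^ a * ∑ n ∈ Finset.Icc 1 N, sStar k n := by
  obtain ⟨r, hr⟩ : ∃ r, k.length = r + 1 :=
    Nat.exists_eq_succ_of_ne_zero (by simpa using hk)
  have hr' : (k ++ [a]).length = r + 2 := by simp [hr]
  rw [sStar_eq_starSum, starSum_cast hr' (k ++ [a]).get (fun i => (k ++ [a]).get (Fin.cast hr'.symm i))
    (fun i => rfl), starSum_snoc r _ hN]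
  congr 1
  · simp [hr]
  · refine Finset.sum_congr rfl fun n hn => ?_
    rw [starSum_bound _ _ (Finset.mem_Icc.1 hn).2, sStar_eq_starSum]
    symm
    refine starSum_cast hr _ _ (fun i => ?_) n n
    simp

/-! ### Iterated integrals with a general integrand in the last variable -/

/-- The density of `ω_{δ(j)}` at position `j = i + 1`, where `δ(j) = 1` iff `j ∈ S`. -/
noncomputable def formDensity (S : Finset ℕ) (i : ℕ) (x : ℝ) : ℝ :=
  if i + 1 ∈ S then 1 / (1 - x) else 1 / x

/-- The order relation between the variables at positions `i + 1` and `i + 2`. -/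
def stepRel (S : Finset ℕ) (i : ℕ) (x y : ℝ) : Prop :=
  if i + 1 ∈ S then x < y else y < x

/-- The domain `Δ` in `n + 1` variables attached to a set `S` of ascents. -/
def chainDomain (S : Finset ℕ) (n : ℕ) : Set (Fin (n + 1) → ℝ) :=
  {t | (∀ j, t j ∈ Set.Ioo (0 : ℝ) 1) ∧
    ∀ i : Fin n, stepRel S i (t i.castSucc) (t i.succ)}

/-- The iterated integral over `chainDomain S n` with integrand `f` in the last variable. -/
noncomputable def chainLIntegral (S : Finset ℕ) (n : ℕ) (f : ℝ → ℝ≥0∞) : ℝ≥0∞ :=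
  ∫⁻ t in chainDomain S n,
    (∏ i : Fin n, ENNReal.ofReal (formDensity S i (t i.castSucc))) * f (t (Fin.last n))

@[fun_prop]
lemma measurable_formDensity (S : Finset ℕ) (i : ℕ) : Measurable (formDensity S i) := by
  unfold formDensity
  split_ifs <;> fun_prop

lemma measurableSet_stepRel (S : Finset ℕ) (i : ℕ) {α : Type*} [MeasurableSpace α]
    {f g : α → ℝ} (hf : Measurable f) (hg : Measurable g) :
    MeasurableSet {a | stepRel S i (f a) (g a)} := by
  unfold stepRel
  split_ifs
  · exact measurableSet_lt hf hg
  · exact measurableSet_lt hg hf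

lemma measurableSet_chainDomain (S : Finset ℕ) (n : ℕ) : MeasurableSet (chainDomain S n) := by
  have : chainDomain S n = (⋂ j, {t | t j ∈ Set.Ioo (0 : ℝ) 1}) ∩
      ⋂ i : Fin n, {t | stepRel S i (t i.castSucc) (t i.succ)} := by
    ext t
    simp [chainDomain]
  rw [this]
  refine (MeasurableSet.iInter fun j => ?_).inter (MeasurableSet.iInter fun i => ?_)
  · exact (measurable_pi_apply j) measurableSet_Ioo
  · exact measurableSet_stepRel S i (measurable_pi_apply _) (measurable_pi_apply _)

lemma snoc_mem_chainDomain (S : Finset ℕ) (n : ℕ) (t : Fin (n + 1) → ℝ) (x : ℝ) :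
    (Fin.snoc t x : Fin (n + 2) → ℝ) ∈ chainDomain S (n + 1) ↔
      t ∈ chainDomain S n ∧ x ∈ {y | y ∈ Set.Ioo (0 : ℝ) 1 ∧ stepRel S n (t (Fin.last n)) y} := by
  have h1 : (∀ j, (Fin.snoc t x : Fin (n + 2) → ℝ) j ∈ Set.Ioo (0 : ℝ) 1) ↔
      (∀ j, t j ∈ Set.Ioo (0 : ℝ) 1) ∧ x ∈ Set.Ioo (0 : ℝ) 1 := by
    rw [Fin.forall_fin_succ']
    simp only [Fin.snoc_castSucc, Fin.snoc_last]
  have h2 : (∀ i : Fin (n + 1), stepRel S i ((Fin.snoc t x : Fin (n + 2) → ℝ) i.castSucc)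
        ((Fin.snoc t x : Fin (n + 2) → ℝ) i.succ)) ↔
      (∀ i : Fin n, stepRel S i (t i.castSucc) (t i.succ)) ∧ stepRel S n (t (Fin.last n)) x := by
    rw [Fin.forall_fin_succ']
    simp only [Fin.snoc_castSucc, Fin.succ_last, Fin.snoc_last, Fin.succ_castSucc,
      Fin.val_castSucc, Fin.val_last]
  simp only [chainDomain, Set.mem_ofPred_eq, h1, h2]
  tauto

lemma chainLIntegral_succ (S : Finset ℕ) (n : ℕ) {f : ℝ → ℝ≥0∞} (hf : Measurable f) :
    chainLIntegral S (n + 1) f =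
      chainLIntegral S n fun s => ENNReal.ofReal (formDensity S n s) *
        ∫⁻ x in {y | y ∈ Set.Ioo (0 : ℝ) 1 ∧ stepRel S n s y}, f x := by
  have hmeas : Measurable fun t : Fin (n + 2) → ℝ =>
      (∏ i : Fin (n + 1), ENNReal.ofReal (formDensity S i (t i.castSucc))) *
        f (t (Fin.last (n + 1))) := by fun_prop
  have hmeas' := hmeas.indicator (measurableSet_chainDomain S (n + 1))
  have hset (s : ℝ) : MeasurableSet {y | y ∈ Set.Ioo (0 : ℝ) 1 ∧ stepRel S n s y} :=
    measurableSet_Ioo.inter (measurableSet_stepRel S n measurable_const measurable_id)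
  unfold chainLIntegral
  rw [← lintegral_indicator (measurableSet_chainDomain S (n + 1)),
    ← lintegral_indicator (measurableSet_chainDomain S n),
    ← ((volume_preserving_piFinSuccAbove (fun _ => ℝ) (Fin.last (n + 1))).symm).lintegral_comp
      hmeas', Measure.volume_eq_prod, lintegral_prod_symm]
  swap
  · exact (hmeas'.comp (MeasurableEquiv.measurable _)).aemeasurable
  refine lintegral_congr fun t => ?_
  have happ (x : ℝ) : (MeasurableEquiv.piFinSuccAbove (fun _ => ℝ) (Fin.last (n + 1))).symm (x, t)
      = (Fin.snoc t x : Fin (n + 2) → ℝ) := by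
    simp [MeasurableEquiv.piFinSuccAbove, Fin.snocEquiv]
  simp only [happ]
  by_cases ht : t ∈ chainDomain S n
  · rw [Set.indicator_of_mem ht, ← lintegral_indicator (hset _), ← mul_assoc,
      ← lintegral_const_mul _ (hf.indicator (hset _))]
    refine lintegral_congr fun x => ?_
    by_cases hx : x ∈ {y | y ∈ Set.Ioo (0 : ℝ) 1 ∧ stepRel S n (t (Fin.last n)) y}
    · rw [Set.indicator_of_mem ((snoc_mem_chainDomain S n t x).2 ⟨ht, hx⟩),
        Set.indicator_of_mem hx, Fin.prod_univ_castSucc]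
      simp only [Fin.snoc_castSucc, Fin.snoc_last, Fin.val_castSucc, Fin.val_last]
    · rw [Set.indicator_of_notMem hx, mul_zero, Set.indicator_of_notMem]
      exact fun h => hx ((snoc_mem_chainDomain S n t x).1 h).2
  · rw [Set.indicator_of_notMem ht]
    simp [snoc_mem_chainDomain, ht]

lemma chainLIntegral_congr (S : Finset ℕ) (n : ℕ) {f g : ℝ → ℝ≥0∞}
    (h : Set.EqOn f g (Set.Ioo 0 1)) : chainLIntegral S n f = chainLIntegral S n g := by
  refine setLIntegral_congr_fun (measurableSet_chainDomain S n) fun t ht => ?_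
  simp only [h (ht.1 (Fin.last n))]

lemma chainLIntegral_congr_set {S S' : Finset ℕ} (n : ℕ) (f : ℝ → ℝ≥0∞)
    (h : ∀ j, j ≤ n → (j ∈ S ↔ j ∈ S')) : chainLIntegral S n f = chainLIntegral S' n f := by
  have h1 (i : Fin n) : formDensity S i = formDensity S' i := by
    funext x
    exact if_congr (h _ i.2) rfl rfl
  have h2 (i : Fin n) : stepRel S i = stepRel S' i := by
    funext x y
    simp only [stepRel, h _ (Nat.succ_le_of_lt i.2)]
  simp only [chainLIntegral, chainDomain, h1, h2]

lemma chainLIntegral_const_mul (S : Finset ℕ) (n : ℕ) (c : ℝ≥0∞) {f : ℝ → ℝ≥0∞}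
    (hf : Measurable f) :
    chainLIntegral S n (fun x => c * f x) = c * chainLIntegral S n f := by
  unfold chainLIntegral
  rw [← lintegral_const_mul _ (by fun_prop)]
  simp only [mul_left_comm]

lemma chainLIntegral_sum (S : Finset ℕ) (n : ℕ) (s : Finset ℕ) {f : ℕ → ℝ → ℝ≥0∞}
    (hf : ∀ m, Measurable (f m)) :
    chainLIntegral S n (fun x => ∑ m ∈ s, f m x) = ∑ m ∈ s, chainLIntegral S n (f m) := by
  unfold chainLIntegral
  rw [← lintegral_finsetSum _ (fun m _ => by have := hf m; fun_prop)]
  simp only [Finset.mul_sum]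

/-- The integrand `x ^ (N - 1)`. -/
noncomputable def powDensity (N : ℕ) (x : ℝ) : ℝ≥0∞ := ENNReal.ofReal (x ^ (N - 1))

@[fun_prop]
lemma measurable_powDensity (N : ℕ) : Measurable (powDensity N) := by
  unfold powDensity
  fun_prop

lemma setLIntegral_powDensity {N : ℕ} (hN : 1 ≤ N) {a b : ℝ} (ha : 0 ≤ a) (hab : a ≤ b) :
    ∫⁻ x in Set.Ioo a b, powDensity N x = ENNReal.ofReal ((b ^ N - a ^ N) / N) := by
  unfold powDensity
  rw [← ofReal_integral_eq_lintegral_ofReal, ← integral_Ioc_eq_integral_Ioo,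
    ← intervalIntegral.integral_of_le hab, integral_pow]
  · congr 2
    · rw [Nat.sub_add_cancel hN]
    · exact_mod_cast Nat.sub_add_cancel hN
  · exact ((continuous_pow (N - 1)).integrableOn_Icc (a := a) (b := b)).mono_set
      Set.Ioo_subset_Icc_self
  · refine (ae_restrict_iff' measurableSet_Ioo).2 (ae_of_all _ fun x hx => ?_)
    exact pow_nonneg (ha.trans hx.1.le) _

lemma chainLIntegral_zero (S : Finset ℕ) {N : ℕ} (hN : 1 ≤ N) :
    chainLIntegral S 0 (powDensity N) = ENNReal.ofReal (1 / N) := by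
  have hmeas : Measurable ((Set.Ioo (0 : ℝ) 1).indicator (powDensity N)) :=
    (measurable_powDensity N).indicator measurableSet_Ioo
  have h := (volume_preserving_funUnique (Fin 1) ℝ).lintegral_comp hmeas
  rw [lintegral_indicator measurableSet_Ioo, setLIntegral_powDensity hN le_rfl zero_le_one] at h
  unfold chainLIntegral
  rw [← lintegral_indicator (measurableSet_chainDomain S 0)]
  convert h using 1
  · refine lintegral_congr fun t => ?_
    simp [Set.indicator, chainDomain]
  · simp [show N ≠ 0 by omega]

lemma chainLIntegral_succ_descent (S : Finset ℕ) (n : ℕ) (h : n + 1 ∉ S) {N : ℕ} (hN : 1 ≤ N) :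
    chainLIntegral S (n + 1) (powDensity N) =
      ENNReal.ofReal (1 / N) * chainLIntegral S n (powDensity N) := by
  rw [chainLIntegral_succ S n (measurable_powDensity N),
    ← chainLIntegral_const_mul S n _ (measurable_powDensity N)]
  refine chainLIntegral_congr S n fun s hs => ?_
  have hset : {y | y ∈ Set.Ioo (0 : ℝ) 1 ∧ stepRel S n s y} = Set.Ioo 0 s := by
    ext y
    simp only [stepRel, if_neg h, Set.mem_ofPred_eq, Set.mem_Ioo]
    exact ⟨fun hy => ⟨hy.1.1, hy.2⟩, fun hy => ⟨⟨hy.1, hy.2.trans hs.2⟩, hy.2⟩⟩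
  have hs0 : s ≠ 0 := hs.1.ne'
  simp only [hset]
  rw [setLIntegral_powDensity hN le_rfl hs.1.le, formDensity, if_neg h, powDensity,
    ← ENNReal.ofReal_mul (by have := hs.1; positivity), ← ENNReal.ofReal_mul (by positivity)]
  congr 1
  obtain ⟨M, rfl⟩ := Nat.exists_eq_add_of_le' hN
  simp only [Nat.add_sub_cancel, pow_succ]
  field_simp
  simp

lemma chainLIntegral_succ_ascent (S : Finset ℕ) (n : ℕ) (h : n + 1 ∈ S) {N : ℕ} (hN : 1 ≤ N) :
    chainLIntegral S (n + 1) (powDensity N) =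
      ENNReal.ofReal (1 / N) * ∑ m ∈ Finset.Icc 1 N, chainLIntegral S n (powDensity m) := by
  rw [chainLIntegral_succ S n (measurable_powDensity N),
    ← chainLIntegral_sum S n _ measurable_powDensity,
    ← chainLIntegral_const_mul S n _ (by fun_prop)]
  refine chainLIntegral_congr S n fun s hs => ?_
  have hset : {y | y ∈ Set.Ioo (0 : ℝ) 1 ∧ stepRel S n s y} = Set.Ioo s 1 := by
    ext y
    simp only [stepRel, if_pos h, Set.mem_ofPred_eq, Set.mem_Ioo]
    exact ⟨fun hy => ⟨hy.2, hy.1.2⟩, fun hy => ⟨⟨hs.1.trans hy.1, hy.2⟩, hy.1⟩⟩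
  have hs1 : 0 < 1 - s := sub_pos.2 hs.2
  have hgeom : ∑ m ∈ Finset.Icc 1 N, s ^ (m - 1) = (1 - s ^ N) / (1 - s) := by
    rw [eq_div_iff hs1.ne', ← geom_sum_mul_neg, ← Finset.Ico_add_one_right_eq_Icc,
      Finset.sum_Ico_eq_sum_range]
    simp
  simp only [hset, powDensity]
  rw [← ENNReal.ofReal_sum_of_nonneg (fun m _ => pow_nonneg hs.1.le _), hgeom]
  have := setLIntegral_powDensity hN hs.1.le hs.2.le
  simp only [powDensity] at this
  rw [this, formDensity, if_pos h, ← ENNReal.ofReal_mul (by positivity),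
    ← ENNReal.ofReal_mul (by positivity)]
  congr 1
  rw [one_pow]
  ring

lemma chainLIntegral_add_descents (S : Finset ℕ) (n : ℕ) {N : ℕ} (hN : 1 ≤ N) (b : ℕ)
    (h : ∀ j, n < j → j ≤ n + b → j ∉ S) :
    chainLIntegral S (n + b) (powDensity N) =
      ENNReal.ofReal (1 / (N : ℝ) ^ b) * chainLIntegral S n (powDensity N) := by
  induction b with
  | zero => simp
  | succ b ih =>
    rw [← add_assoc, chainLIntegral_succ_descent S _ (h _ (by omega) (by omega)) hN,
      ih fun j h1 h2 => h j h1 (by omega), ← mul_assoc, ← ENNReal.ofReal_mul (by positivity)]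
    congr 2
    rw [pow_succ]
    ring

/-! ### The set of partial sums -/

lemma Aset_singleton (a : ℕ) : Aset [a] = ∅ := by
  simp [Aset]

lemma Aset_append (k : List ℕ) (hk : k ≠ []) (a : ℕ) :
    Aset (k ++ [a]) = insert k.sum (Aset k) := by
  have hl : 1 ≤ k.length := List.length_pos_iff.2 hk
  unfold Aset
  rw [List.length_append, List.length_singleton, ← Finset.insert_Ico_right_eq_Ico_add_one hl,
    Finset.image_insert]
  congr 1
  · simp
  · refine Finset.image_congr fun i hi => ?_
    have : i < k.length := (Finset.mem_Ico.1 hi).2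
    simp only [List.take_append_of_le_length this.le]

lemma lt_sum_of_mem_Aset {k : List ℕ} (hpos : ∀ x ∈ k, 0 < x) {j : ℕ} (hj : j ∈ Aset k) :
    j < k.sum := by
  obtain ⟨i, hi, rfl⟩ := Finset.mem_image.1 hj
  have hi' : i < k.length := (Finset.mem_Ico.1 hi).2
  conv_rhs => rw [← List.take_append_drop i k, List.sum_append]
  have : 0 < (k.drop i).sum :=
    List.sum_pos _ (fun x hx => hpos x (List.mem_of_mem_drop hx))
      (by simpa [List.drop_eq_nil_iff] using hi')
  omega

/-! ### The integral representation -/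

lemma ofReal_sStar_eq_chainLIntegral (k : List ℕ) (hk : k ≠ []) (hpos : ∀ x ∈ k, 0 < x) :
    ∀ N, 1 ≤ N →
      ENNReal.ofReal (sStar k N) = chainLIntegral (Aset k) (k.sum - 1) (powDensity N) := by
  induction k using List.reverseRecOn with
  | nil => exact absurd rfl hk
  | append_singleton k a ih =>
    intro N hN
    have ha : 0 < a := hpos a (by simp)
    obtain ⟨b, rfl⟩ := Nat.exists_eq_add_of_le' ha
    rcases eq_or_ne k [] with rfl | hk'
    · have h := chainLIntegral_add_descents ∅ 0 hN b (by simp)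
      rw [chainLIntegral_zero ∅ hN, ← ENNReal.ofReal_mul (by positivity), zero_add] at h
      simp only [List.nil_append, Aset_singleton, List.sum_singleton, Nat.add_sub_cancel, h,
        sStar_singleton _ hN]
      congr 1
      rw [pow_succ]
      ring
    · have hpos' : ∀ x ∈ k, 0 < x := fun x hx => hpos x (by simp [hx])
      obtain ⟨n, hn⟩ : ∃ n, k.sum = n + 1 :=
        Nat.exists_eq_succ_of_ne_zero (List.sum_pos _ hpos' hk').ne'
      have hA := Aset_append k hk' (b + 1)
      rw [hn] at hA
      have hsum : (k ++ [b + 1]).sum - 1 = n + 1 + b := by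
        rw [List.sum_append, List.sum_singleton, hn]
        omega
      rw [hsum, chainLIntegral_add_descents _ _ hN b, chainLIntegral_succ_ascent _ _ _ hN,
        sStar_append k hk' _ hN, ENNReal.ofReal_mul (by positivity),
        ENNReal.ofReal_sum_of_nonneg fun m _ => sStar_nonneg k m, ← mul_assoc,
        ← ENNReal.ofReal_mul (by positivity)]
      · congr 1
        · congr 1
          rw [pow_succ]
          ring
        · refine Finset.sum_congr rfl fun m hm => ?_
          rw [ih hk' hpos' m (Finset.mem_Icc.1 hm).1, hn, Nat.add_sub_cancel]
          refine chainLIntegral_congr_set n _ fun j hj => ?_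
          rw [hA, Finset.mem_insert]
          exact ⟨Or.inr, fun h => h.resolve_left (by omega)⟩
      · simp [hA]
      · intro j hj _ hjA
        rw [hA, Finset.mem_insert] at hjA
        rcases hjA with rfl | hjA
        · omega
        · have := lt_sum_of_mem_Aset hpos' hjA
          omega

lemma formDensity_nonneg (S : Finset ℕ) (i : ℕ) {x : ℝ} (hx : x ∈ Set.Ioo (0 : ℝ) 1) :
    0 ≤ formDensity S i x := by
  have h0 := hx.1
  have h1 := sub_pos.2 hx.2
  unfold formDensity
  split_ifs <;> positivity

lemma integral_chainDomain (S : Finset ℕ) (n N : ℕ) :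
    ∫ t in chainDomain S n, ∏ i : Fin (n + 1),
        (if (i : ℕ) + 1 = n + 1 then (t i) ^ (N - 1)
          else if (i : ℕ) + 1 ∈ S then 1 / (1 - t i)
          else 1 / t i) =
      (chainLIntegral S n (powDensity N)).toReal := by
  have hprod (t : Fin (n + 1) → ℝ) : (∏ i : Fin (n + 1),
        (if (i : ℕ) + 1 = n + 1 then (t i) ^ (N - 1)
          else if (i : ℕ) + 1 ∈ S then 1 / (1 - t i)
          else 1 / t i)) =
      (∏ i : Fin n, formDensity S i (t i.castSucc)) * t (Fin.last n) ^ (N - 1) := by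
    rw [Fin.prod_univ_castSucc]
    congr 1
    · refine Finset.prod_congr rfl fun i _ => ?_
      have := i.2
      rw [if_neg (by simp; omega)]
      rfl
    · simp
  simp only [hprod]
  rw [integral_eq_lintegral_of_nonneg_ae]
  · congr 1
    refine setLIntegral_congr_fun (measurableSet_chainDomain S n) fun t ht => ?_
    have hnn (i : Fin n) := formDensity_nonneg S i (ht.1 i.castSucc)
    simp only [powDensity]
    rw [ENNReal.ofReal_mul (Finset.prod_nonneg fun i _ => hnn i),
      ENNReal.ofReal_prod_of_nonneg fun i _ => hnn i]
  · refine (ae_restrict_iff' (measurableSet_chainDomain S n)).2 (ae_of_all _ fun t ht => ?_)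
    exact mul_nonneg (Finset.prod_nonneg fun i _ => formDensity_nonneg S i (ht.1 _))
      (pow_nonneg (ht.1 _).1.le _)
  · exact Measurable.aestronglyMeasurable (by fun_prop)

/-- Integral representation of `s⋆(k, N)`:
`s⋆(k,N) = ∫_{Δ(k)} ω_{δ(1)}(t₁) ⋯ ω_{δ(k-1)}(t_{k-1}) · t_k^{N-1} dt_k`. -/
theorem sStar_eq_integral (k : List ℕ) (hk : k ≠ []) (hpos : ∀ x ∈ k, 0 < x)
    (N : ℕ) (hN : 1 ≤ N) :
    sStar k N =
      ∫ t in Delta k,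
        ∏ i : Fin k.sum,
          if (i : ℕ) + 1 = k.sum then (t i) ^ (N - 1)
          else if (i : ℕ) + 1 ∈ Aset k then 1 / (1 - t i)
          else 1 / t i := by
  have hmain := ofReal_sStar_eq_chainLIntegral k hk hpos N hN
  have hsum : 0 < k.sum := List.sum_pos _ hpos hk
  rw [← ENNReal.toReal_ofReal (sStar_nonneg k N), hmain]
  unfold Delta
  generalize Aset k = S
  generalize k.sum = w at hsum
  obtain ⟨n, rfl⟩ := Nat.exists_eq_succ_of_ne_zero hsum.ne'
  rw [Nat.succ_sub_one, ← integral_chainDomain]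
  congr 2
  ext t
  refine and_congr_right fun _ => ⟨fun h i hi => ?_, fun h i => ?_⟩
  · exact h ⟨i, by omega⟩
  · exact h i.castSucc (by simp)

end Kawashima
end

section
/- If a nonempty index k is written k=(k_1,…,k_q,1,…,1) with l trailing ones and either q=0 or k_q>1, then the last component ρ of the Hoffman dual k∨ of k equals l+1 if q≥1, and equals l if q=0. -/
open MeasureTheory Filter Topology

namespace Kawashima

theorem _root_.Finset.sort_insert_of_forall_lt {α : Type*} [LinearOrder α] {s : Finset α} {a : α}
    (h : ∀ b ∈ s, b < a) : (insert a s).sort (· ≤ ·) = s.sort (· ≤ ·) ++ [a] := by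
  have hnodup : (s.sort (· ≤ ·) ++ [a]).Nodup := by
    have ha : a ∉ s := fun ha => (h a ha).false
    simpa [List.nodup_append, Finset.sort_nodup] using fun b hb (hba : b = a) => ha (hba ▸ hb)
  have hsorted : (s.sort (· ≤ ·) ++ [a]).Pairwise (· ≤ ·) := by
    simpa [List.pairwise_append, Finset.pairwise_sort] using fun b hb => (h b hb).le
  rw [← (List.toFinset_sort (· ≤ ·) hnodup).2 hsorted]
  congr 1
  ext b
  simp

theorem getLast?_zipWith_sub_append_singleton (M : List ℕ) (a w : ℕ) :
    ((M ++ [w]).zipWith (fun x y => x - y) (a :: (M ++ [w]))).getLast? =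
      some (w - (a :: M).getLast (List.cons_ne_nil a M)) := by
  induction M generalizing a with
  | nil => simp
  | cons b M ih =>
    rw [List.cons_append, List.zipWith_cons_cons, List.getLast?_cons, ih b]
    simp

/-- The last component of `k∨` is `wt(k) - p`, where `p` is the largest element of
`{0, …, wt(k) - 1}` that is `0` or lies outside `A(k)`. -/
theorem hdual_getLast?_eq {k : List ℕ} {p : ℕ} (hp : p < k.sum) (hpA : p = 0 ∨ p ∉ Aset k)
    (hmax : ∀ n, p < n → n < k.sum → n ∈ Aset k) :
    (hdual k).getLast? = some (k.sum - p) := by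
  have hlt : ∀ b ∈ Finset.Icc 1 (k.sum - 1) \ Aset k, b < k.sum := by
    intro b hb
    simp only [Finset.mem_sdiff, Finset.mem_Icc] at hb
    omega
  simp only [hdual, Finset.sort_insert_of_forall_lt hlt, getLast?_zipWith_sub_append_singleton]
  set M := (Finset.Icc 1 (k.sum - 1) \ Aset k).sort (· ≤ ·) with hM
  have hmem : ∀ b, b ∈ 0 :: M ↔ b = 0 ∨ (1 ≤ b ∧ b ≤ k.sum - 1) ∧ b ∉ Aset k := by
    simp [hM]
  have hsorted : (0 :: M).Pairwise (· ≤ ·) := by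
    simp [hM, Finset.pairwise_sort]
  have hle : p ≤ (0 :: M).getLast (List.cons_ne_nil 0 M) := by
    refine hsorted.rel_getLast ((hmem p).2 ?_)
    rcases Nat.eq_zero_or_pos p with h0 | h0
    · exact Or.inl h0
    · exact Or.inr ⟨by omega, hpA.resolve_left h0.ne'⟩
  have hge : (0 :: M).getLast (List.cons_ne_nil 0 M) ≤ p := by
    rcases (hmem _).1 (List.getLast_mem (List.cons_ne_nil 0 M)) with h | ⟨h, hA⟩
    · omega
    · by_contra! hlt'
      exact hA (hmax _ hlt' (by omega))
  rw [le_antisymm hge hle]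

theorem mem_Aset {k : List ℕ} {n : ℕ} :
    n ∈ Aset k ↔ ∃ i, (1 ≤ i ∧ i < k.length) ∧ (k.take i).sum = n := by
  simp [Aset]

theorem sum_take_length_add_append_replicate_one (ks : List ℕ) {l j : ℕ} (hj : j ≤ l) :
    ((ks ++ List.replicate l 1).take (ks.length + j)).sum = ks.sum + j := by
  simp [List.take_append, List.take_replicate, List.take_of_length_le, hj]

theorem sum_take_append_replicate_one_ne {ks : List ℕ} (hks : ks ≠ [])
    (hlast : 1 < ks.getLast hks) (l i : ℕ) :
    ((ks ++ List.replicate l 1).take i).sum ≠ ks.sum - 1 := by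
  have hsum : ks.dropLast.sum + ks.getLast hks = ks.sum := by
    conv_rhs => rw [← List.dropLast_append_getLast hks]
    simp
  rcases lt_or_ge i ks.length with hi | hi
  · have hle : (ks.take i).sum ≤ ks.dropLast.sum := by
      rw [List.dropLast_eq_take]
      exact (List.take_sublist_take_left (by omega)).sum_le_sum (by simp)
    rw [List.take_append_of_le_length hi.le]
    omega
  · rw [List.take_append, List.take_of_length_le hi, List.sum_append]
    omega

/-- If `k = (k₁,…,k_q,1,…,1)` with `l` trailing ones and either `q = 0`
or `k_q > 1`, then the last component of the Hoffman dual of `k` is `l+1` if `q ≥ 1`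
and `l` if `q = 0`. -/
theorem hdual_getLast (q l : ℕ) (ks : List ℕ) (hlen : ks.length = q)
    (hpos : ∀ x ∈ ks, 0 < x)
    (hlast : q = 0 ∨ ∃ h : ks ≠ [], 1 < ks.getLast h)
    (hne : ks ++ List.replicate l 1 ≠ []) :
    (hdual (ks ++ List.replicate l 1)).getLast? =
      some (if 1 ≤ q then l + 1 else l) := by
  rcases hlast with rfl | ⟨hks, hlast⟩
  · obtain rfl := List.length_eq_zero_iff.1 hlen
    have hl : 0 < l := Nat.pos_of_ne_zero fun h => hne (by simp [h])
    rw [hdual_getLast?_eq (p := 0) (by simpa using hl) (Or.inl rfl)]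
    · simp
    · intro n hn hnl
      simp only [List.nil_append, List.sum_replicate, smul_eq_mul, mul_one] at hnl
      exact mem_Aset.2 ⟨n, by simp; omega, by
        simpa using sum_take_length_add_append_replicate_one [] hnl.le⟩
  · have hq : 0 < ks.length := List.length_pos_iff.2 hks
    have hsum : 1 < ks.sum := hlast.trans_le (List.le_sum_of_mem (List.getLast_mem hks))
    rw [hdual_getLast?_eq (p := ks.sum - 1)]
    · rw [if_pos (by omega)]
      simp
      omega
    · simp
      omega
    · right
      rw [mem_Aset]
      rintro ⟨i, -, hi⟩
      exact sum_take_append_replicate_one_ne hks hlast l i hi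
    · intro n hn hnl
      simp only [List.sum_append, List.sum_replicate, smul_eq_mul, mul_one] at hnl
      refine mem_Aset.2 ⟨ks.length + (n - ks.sum), by simp; omega, ?_⟩
      rw [sum_take_length_add_append_replicate_one ks (by omega)]
      omega

end Kawashima
end
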